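/- Let ν > 3, |ε₀| sufficiently small, λ(t) := t^{-1-ν} exp(−ε₀ sin(log t)), μ(t) := tλ(t), β_j(t) := (j−1/2)(ν + ε₀ cos(log t)) − 1/2 for j = 1,2. Suppose q_j : {0 < t < t₀} × [0,1] → ℝ are smooth solutions of ((1−a²)∂_a² + (2(β_j(t)−1)a + 2a^{-1})∂_a − β_j² + β_j − tβ_j')q_j − (t²∂_t²q_j + 2β_j t ∂_t q_j) + 2at∂_a∂_t q_j = c_j(t) a^{2−j}, where c_j are smooth with |∂_t^k c_j(t)| ≤ C_k t^{-k} for all k, with boundary conditions q_j(0,t) = ∂_a q_j(0,t) = 0 and satisfying |∂_t^k ∂_a^ℓ q₂(a,t)| ≤ C_k t^{-k} a^{2−ℓ} and |∂_t^k ∂_a^ℓ q₁(a,t)| ≤ C_k t^{-k} a^{3−ℓ} for all k ≥ 0 and 0 ≤ ℓ ≤ 2. Define v₂(t,r) := λ(t)^{1/2} (μ(t)^{-1} q₁(r/t, t) + μ(t)^{-2} q₂(r/t, t)). Then for all integers k, ℓ ≥ 0 there are constants C_{k,ℓ} such that |∂_t^k ∂_r^ℓ v₂(t,r)| ≤ C_{k,ℓ}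 t^{-k} r^{-ℓ} λ(t)^{1/2} a²(1 + R) / μ(t)² for all 0 < t < t₀ and 0 < r ≤ t/2, where a = r/t and R = rλ(t). -/

import Mathlib

noncomputable section

/-- The scaling factor `λ(t) = t^{-1-ν} exp(−ε₀ sin(log t))`. -/
def lam (ν ε₀ t : ℝ) : ℝ := t ^ (-1 - ν) * Real.exp (-ε₀ * Real.sin (Real.log t))

/-- `μ(t) = t λ(t)`. -/
def mu (ν ε₀ t : ℝ) : ℝ := t * lam ν ε₀ t

/-- `β_j(t) = (j − 1/2)(ν + ε₀ cos(log t)) − 1/2`. -/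
def betaJ (ν ε₀ : ℝ) (j : ℕ) (t : ℝ) : ℝ :=
  ((j : ℝ) - 1 / 2) * (ν + ε₀ * Real.cos (Real.log t)) - 1 / 2

/-- Mixed partial derivative `∂_a^k ∂_t^l q (a,t)` for `q = q(a,t)`. -/
def pdat (k l : ℕ) (q : ℝ → ℝ → ℝ) (a t : ℝ) : ℝ :=
  iteratedDeriv k (fun a' => iteratedDeriv l (fun t' => q a' t') t) a

/-- Mixed partial derivative `∂_t^k ∂_r^j v (t,r)` for `v = v(t,r)`. -/
def pd (k j : ℕ) (v : ℝ → ℝ → ℝ) (t r : ℝ) : ℝ :=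
  iteratedDeriv k (fun t' => iteratedDeriv j (fun r' => v t' r') r) t

/-- The second correction `v₂(t,r) = λ^{1/2}(μ^{-1} q₁(r/t,t) + μ^{-2} q₂(r/t,t))`. -/
def v2 (ν ε₀ : ℝ) (q : ℕ → ℝ → ℝ → ℝ) (t r : ℝ) : ℝ :=
  (lam ν ε₀ t) ^ ((1 : ℝ) / 2) *
    ((mu ν ε₀ t)⁻¹ * q 1 (r / t) t + ((mu ν ε₀ t) ^ 2)⁻¹ * q 2 (r / t) t)

/-- Smoothness of a function of `(a, t)` on `Ω`. -/
def SmoothOn (Ω : Set (ℝ × ℝ)) (f : ℝ × ℝ → ℝ) : Prop :=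
  ContDiffOn ℝ (⊤ : ℕ∞) f Ω

/-- `X` acts on functions smooth on `Ω` as a derivation, up to equality on `Ω`. -/
structure IsDerivationOn (Ω : Set (ℝ × ℝ)) (X : (ℝ × ℝ → ℝ) → ℝ × ℝ → ℝ) : Prop where
  smooth : ∀ {f}, SmoothOn Ω f → SmoothOn Ω (X f)
  congr : ∀ {f g}, Set.EqOn f g Ω → Set.EqOn (X f) (X g) Ω
  add : ∀ {f g}, SmoothOn Ω f → SmoothOn Ω g → Set.EqOn (X (f + g)) (X f + X g) Ω
  mul : ∀ {f g}, SmoothOn Ω f → SmoothOn Ω g → Set.EqOn (X (f * g)) (X f * g + f * X g) Ω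
  const : ∀ c : ℝ, Set.EqOn (X (fun _ => c)) 0 Ω

/-- The derivative of `f` in the fixed direction `v`. -/
def dirDeriv (v : ℝ × ℝ) (f : ℝ × ℝ → ℝ) (p : ℝ × ℝ) : ℝ := fderiv ℝ f p v

theorem SmoothOn.differentiableAt {Ω : Set (ℝ × ℝ)} (hΩ : IsOpen Ω) {f : ℝ × ℝ → ℝ}
    (hf : SmoothOn Ω f) {p : ℝ × ℝ} (hp : p ∈ Ω) : DifferentiableAt ℝ f p :=
  (ContDiffOn.contDiffAt hf (hΩ.mem_nhds hp)).differentiableAt (by simp)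

theorem SmoothOn.mul {Ω : Set (ℝ × ℝ)} {f g : ℝ × ℝ → ℝ} (hf : SmoothOn Ω f)
    (hg : SmoothOn Ω g) : SmoothOn Ω (f * g) :=
  ContDiffOn.mul hf hg

theorem SmoothOn.fderiv {Ω : Set (ℝ × ℝ)} (hΩ : IsOpen Ω) {f : ℝ × ℝ → ℝ}
    (hf : SmoothOn Ω f) : ContDiffOn ℝ (⊤ : ℕ∞) (_root_.fderiv ℝ f) Ω :=
  ContDiffOn.fderiv_of_isOpen hf hΩ (by simp)

theorem isDerivationOn_dirDeriv {Ω : Set (ℝ × ℝ)} (hΩ : IsOpen Ω) (v : ℝ × ℝ) :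
    IsDerivationOn Ω (dirDeriv v) where
  smooth hf := (hf.fderiv hΩ).clm_apply contDiffOn_const
  congr h p hp := by
    have : _ =ᶠ[nhds p] _ := h.eventuallyEq_of_mem (hΩ.mem_nhds hp)
    simp [dirDeriv, this.fderiv_eq]
  add hf hg p hp := by
    simp [dirDeriv, fderiv_add (hf.differentiableAt hΩ hp) (hg.differentiableAt hΩ hp)]
  mul hf hg p hp := by
    simp [dirDeriv, fderiv_mul (hf.differentiableAt hΩ hp) (hg.differentiableAt hΩ hp)]
    ring
  const c p hp := by simp [dirDeriv]

theorem IsDerivationOn.mul_left {Ω : Set (ℝ × ℝ)} {X : (ℝ × ℝ → ℝ) → ℝ × ℝ → ℝ}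
    (hX : IsDerivationOn Ω X) {φ : ℝ × ℝ → ℝ} (hφ : SmoothOn Ω φ) :
    IsDerivationOn Ω (fun f => φ * X f) where
  smooth hf := ContDiffOn.mul hφ (hX.smooth hf)
  congr h p hp := by simp [hX.congr h hp]
  add hf hg p hp := by simp [hX.add hf hg hp]; ring
  mul hf hg p hp := by simp [hX.mul hf hg hp]; ring
  const c p hp := by simp [hX.const c hp]

/-- The scaling field `a ∂_a`. -/
def aDeriv (f : ℝ × ℝ → ℝ) : ℝ × ℝ → ℝ := Prod.fst * dirDeriv (1, 0) f

/-- The scaling field `t ∂_t`. -/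
def tDeriv (f : ℝ × ℝ → ℝ) : ℝ × ℝ → ℝ := Prod.snd * dirDeriv (0, 1) f

theorem isDerivationOn_aDeriv {Ω : Set (ℝ × ℝ)} (hΩ : IsOpen Ω) : IsDerivationOn Ω aDeriv :=
  (isDerivationOn_dirDeriv hΩ (1, 0)).mul_left contDiffOn_fst

theorem isDerivationOn_tDeriv {Ω : Set (ℝ × ℝ)} (hΩ : IsOpen Ω) : IsDerivationOn Ω tDeriv :=
  (isDerivationOn_dirDeriv hΩ (0, 1)).mul_left contDiffOn_snd

theorem dirDeriv_comm {Ω : Set (ℝ × ℝ)} (hΩ : IsOpen Ω) {f : ℝ × ℝ → ℝ} (hf : SmoothOn Ω f)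
    (v w : ℝ × ℝ) : Set.EqOn (dirDeriv v (dirDeriv w f)) (dirDeriv w (dirDeriv v f)) Ω := by
  intro p hp
  have hd : DifferentiableAt ℝ (fderiv ℝ f) p :=
    ((hf.fderiv hΩ).contDiffAt (hΩ.mem_nhds hp)).differentiableAt (by simp)
  have key : ∀ v w : ℝ × ℝ, dirDeriv v (dirDeriv w f) p = fderiv ℝ (fderiv ℝ f) p v w := by
    intro v w
    have : dirDeriv w f = fun q => (fderiv ℝ f q) w := rfl
    rw [this, dirDeriv, fderiv_clm_apply hd (differentiableAt_const w)]
    simp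
  rw [key, key]
  exact ((ContDiffOn.contDiffAt hf (hΩ.mem_nhds hp)).isSymmSndFDerivAt
    (by
      rw [minSmoothness_of_isRCLikeNormedField]
      exact WithTop.coe_le_coe.2 (le_top : (2 : ℕ∞) ≤ ⊤))) v w

theorem dirDeriv_fst (v p : ℝ × ℝ) : dirDeriv v Prod.fst p = v.1 := by
  simp [dirDeriv, fderiv_fst]

theorem dirDeriv_snd (v p : ℝ × ℝ) : dirDeriv v Prod.snd p = v.2 := by
  simp [dirDeriv, fderiv_snd]

theorem aDeriv_tDeriv {Ω : Set (ℝ × ℝ)} (hΩ : IsOpen Ω) {f : ℝ × ℝ → ℝ} (hf : SmoothOn Ω f)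
    {p : ℝ × ℝ} (hp : p ∈ Ω) :
    aDeriv (tDeriv f) p = p.1 * p.2 * dirDeriv (1, 0) (dirDeriv (0, 1) f) p := by
  have h := (isDerivationOn_dirDeriv hΩ (1, 0)).mul (f := Prod.snd) contDiffOn_snd
    ((isDerivationOn_dirDeriv hΩ (0, 1)).smooth hf) hp
  simp only [Pi.add_apply, Pi.mul_apply, dirDeriv_snd] at h
  simp only [aDeriv, tDeriv, Pi.mul_apply, h]
  ring

theorem tDeriv_aDeriv {Ω : Set (ℝ × ℝ)} (hΩ : IsOpen Ω) {f : ℝ × ℝ → ℝ} (hf : SmoothOn Ω f)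
    {p : ℝ × ℝ} (hp : p ∈ Ω) :
    tDeriv (aDeriv f) p = p.1 * p.2 * dirDeriv (1, 0) (dirDeriv (0, 1) f) p := by
  have h := (isDerivationOn_dirDeriv hΩ (0, 1)).mul (f := Prod.fst) contDiffOn_fst
    ((isDerivationOn_dirDeriv hΩ (1, 0)).smooth hf) hp
  simp only [Pi.add_apply, Pi.mul_apply, dirDeriv_fst] at h
  simp only [aDeriv, tDeriv, Pi.mul_apply, h, dirDeriv_comm hΩ hf (1, 0) (0, 1) hp]
  ring

theorem aDeriv_aDeriv {Ω : Set (ℝ × ℝ)} (hΩ : IsOpen Ω) {f : ℝ × ℝ → ℝ} (hf : SmoothOn Ω f)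
    {p : ℝ × ℝ} (hp : p ∈ Ω) :
    aDeriv (aDeriv f) p = aDeriv f p + p.1 ^ 2 * dirDeriv (1, 0) (dirDeriv (1, 0) f) p := by
  have h := (isDerivationOn_dirDeriv hΩ (1, 0)).mul (f := Prod.fst) contDiffOn_fst
    ((isDerivationOn_dirDeriv hΩ (1, 0)).smooth hf) hp
  simp only [Pi.add_apply, Pi.mul_apply, dirDeriv_fst] at h
  simp only [aDeriv, Pi.mul_apply, h]
  ring

theorem tDeriv_tDeriv {Ω : Set (ℝ × ℝ)} (hΩ : IsOpen Ω) {f : ℝ × ℝ → ℝ} (hf : SmoothOn Ω f)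
    {p : ℝ × ℝ} (hp : p ∈ Ω) :
    tDeriv (tDeriv f) p = tDeriv f p + p.2 ^ 2 * dirDeriv (0, 1) (dirDeriv (0, 1) f) p := by
  have h := (isDerivationOn_dirDeriv hΩ (0, 1)).mul (f := Prod.snd) contDiffOn_snd
    ((isDerivationOn_dirDeriv hΩ (0, 1)).smooth hf) hp
  simp only [Pi.add_apply, Pi.mul_apply, dirDeriv_snd] at h
  simp only [tDeriv, Pi.mul_apply, h]
  ring

/-- A class of pairs (weight, function smooth on `Ω`) with the algebraic closure properties of
symbol estimates. -/
structure IsSymbolClass (Ω : Set (ℝ × ℝ)) (P : (ℝ × ℝ → ℝ) → (ℝ × ℝ → ℝ) → Prop) : Prop where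
  smooth : ∀ {w f}, P w f → SmoothOn Ω f
  congr : ∀ {w f g}, P w f → Set.EqOn g f Ω → P w g
  mono : ∀ {w w' f}, P w f → (∀ p ∈ Ω, 0 ≤ w p ∧ w p ≤ w' p) → P w' f
  zero : ∀ w, P w 0
  add : ∀ {w f g}, P w f → P w g → P w (f + g)
  mul : ∀ {w w' f g}, P w f → P w' g → P (w * w') (f * g)

/-- Smooth functions on `Ω` bounded by a multiple of the weight. -/
def BoundedBy (Ω : Set (ℝ × ℝ)) (w f : ℝ × ℝ → ℝ) : Prop :=
  SmoothOn Ω f ∧ ∃ C : ℝ, ∀ p ∈ Ω, |f p| ≤ C * w p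

theorem isSymbolClass_boundedBy (Ω : Set (ℝ × ℝ)) : IsSymbolClass Ω (BoundedBy Ω) where
  smooth h := h.1
  congr := by
    rintro w f g ⟨hf, C, hC⟩ h
    exact ⟨ContDiffOn.congr hf h, C, fun p hp => by rw [h hp]; exact hC p hp⟩
  mono := by
    rintro w w' f ⟨hf, C, hC⟩ h
    refine ⟨hf, |C|, fun p hp => (hC p hp).trans ?_⟩
    obtain ⟨h0, h1⟩ := h p hp
    exact mul_le_mul (le_abs_self C) h1 h0 (abs_nonneg C)
  zero w := ⟨contDiffOn_const, 0, fun p _ => by simp⟩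
  add := by
    rintro w f g ⟨hf, C, hC⟩ ⟨hg, C', hC'⟩
    refine ⟨ContDiffOn.add hf hg, C + C', fun p hp => (abs_add_le _ _).trans ?_⟩
    linarith [hC p hp, hC' p hp]
  mul := by
    rintro w w' f g ⟨hf, C, hC⟩ ⟨hg, C', hC'⟩
    refine ⟨ContDiffOn.mul hf hg, C * C', fun p hp => ?_⟩
    have := mul_le_mul (hC p hp) (hC' p hp) (abs_nonneg _) ((abs_nonneg _).trans (hC p hp))
    simp only [Pi.mul_apply, abs_mul]
    linarith

/-- The functions whose `X`-derivatives up to order `n` belong to `P`, with the same weight. -/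
def StableUpTo (X : (ℝ × ℝ → ℝ) → ℝ × ℝ → ℝ) (P : (ℝ × ℝ → ℝ) → (ℝ × ℝ → ℝ) → Prop) :
    ℕ → (ℝ × ℝ → ℝ) → (ℝ × ℝ → ℝ) → Prop
  | 0, w, f => P w f
  | n + 1, w, f => P w f ∧ StableUpTo X P n w (X f)

/-- The functions all of whose `X`-derivatives belong to `P`, with the same weight. -/
def Stable (X : (ℝ × ℝ → ℝ) → ℝ × ℝ → ℝ) (P : (ℝ × ℝ → ℝ) → (ℝ × ℝ → ℝ) → Prop)
    (w f : ℝ × ℝ → ℝ) : Prop :=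
  ∀ n, StableUpTo X P n w f

section Stable

variable {Ω : Set (ℝ × ℝ)} {X : (ℝ × ℝ → ℝ) → ℝ × ℝ → ℝ}
  {P : (ℝ × ℝ → ℝ) → (ℝ × ℝ → ℝ) → Prop}

theorem StableUpTo.base {n : ℕ} {w f : ℝ × ℝ → ℝ} (h : StableUpTo X P n w f) : P w f := by
  cases n with
  | zero => exact h
  | succ n => exact h.1

theorem StableUpTo.of_succ {n : ℕ} {w f : ℝ × ℝ → ℝ} (h : StableUpTo X P (n + 1) w f) :
    StableUpTo X P n w f := by
  induction n generalizing f with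
  | zero => exact h.1
  | succ n ih => exact ⟨h.1, ih h.2⟩

theorem Stable.base {w f : ℝ × ℝ → ℝ} (h : Stable X P w f) : P w f := h 0

theorem Stable.deriv {w f : ℝ × ℝ → ℝ} (h : Stable X P w f) : Stable X P w (X f) :=
  fun n => (h (n + 1)).2

theorem IsSymbolClass.stableUpTo (hP : IsSymbolClass Ω P) (hX : IsDerivationOn Ω X) (n : ℕ) :
    IsSymbolClass Ω (StableUpTo X P n) := by
  induction n with
  | zero => exact hP
  | succ n ih =>
    exact
      { smooth := fun h => hP.smooth h.1
        congr := fun h e => ⟨hP.congr h.1 e, ih.congr h.2 (hX.congr e)⟩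
        mono := fun h e => ⟨hP.mono h.1 e, ih.mono h.2 e⟩
        zero := fun w => ⟨hP.zero w, ih.congr (ih.zero w) (hX.const 0)⟩
        add := fun h h' => ⟨hP.add h.1 h'.1,
          ih.congr (ih.add h.2 h'.2) (hX.add (hP.smooth h.1) (hP.smooth h'.1))⟩
        mul := fun h h' => ⟨hP.mul h.1 h'.1,
          ih.congr (ih.add (ih.mul h.2 h'.of_succ) (ih.mul h.of_succ h'.2))
            (hX.mul (hP.smooth h.1) (hP.smooth h'.1))⟩ }

theorem IsSymbolClass.stable (hP : IsSymbolClass Ω P) (hX : IsDerivationOn Ω X) :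
    IsSymbolClass Ω (Stable X P) where
  smooth h := hP.smooth h.base
  congr h e n := (hP.stableUpTo hX n).congr (h n) e
  mono h e n := (hP.stableUpTo hX n).mono (h n) e
  zero w n := (hP.stableUpTo hX n).zero w
  add h h' n := (hP.stableUpTo hX n).add (h n) (h' n)
  mul h h' n := (hP.stableUpTo hX n).mul (h n) (h' n)

theorem IsSymbolClass.one_mul (hP : IsSymbolClass Ω P) {w f g : ℝ × ℝ → ℝ} (hf : P 1 f)
    (hg : P w g) : P w (f * g) := by
  simpa using hP.mul hf hg

theorem stable_of_step {w f : ℝ × ℝ → ℝ} (h0 : P w f)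
    (h : ∀ n, StableUpTo X P n w f → StableUpTo X P n w (X f)) : Stable X P w f := by
  intro n
  induction n with
  | zero => exact h0
  | succ n ih => exact ⟨h0, h n ih⟩

theorem stable_of_two_step {w f : ℝ × ℝ → ℝ} (h0 : P w f) (h1 : P w (X f))
    (h : ∀ n, StableUpTo X P (n + 1) w f → StableUpTo X P n w (X (X f))) : Stable X P w f := by
  have key : ∀ n, StableUpTo X P (n + 1) w f := by
    intro n
    induction n with
    | zero => exact ⟨h0, h1⟩
    | succ n ih => exact ⟨h0, h1, h n ih⟩
  exact fun n => (key n).of_succ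

theorem IsSymbolClass.stable_of_deriv_eq_zero (hP : IsSymbolClass Ω P)
    (hX : IsDerivationOn Ω X) {w f : ℝ × ℝ → ℝ} (h0 : P w f) (h : Set.EqOn (X f) 0 Ω) :
    Stable X P w f :=
  stable_of_step h0 fun n _ => (hP.stableUpTo hX n).congr ((hP.stableUpTo hX n).zero w) h

theorem IsSymbolClass.stable_of_deriv_eq_mul (hP : IsSymbolClass Ω P)
    (hX : IsDerivationOn Ω X) {w f α : ℝ × ℝ → ℝ} (h0 : P w f) (hα : Stable X P 1 α)
    (h : Set.EqOn (X f) (α * f) Ω) : Stable X P w f :=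
  stable_of_step h0 fun n hn =>
    (hP.stableUpTo hX n).congr ((hP.stableUpTo hX n).one_mul (hα n) hn) h

theorem IsSymbolClass.stableUpTo_comm {Y : (ℝ × ℝ → ℝ) → ℝ × ℝ → ℝ} (hP : IsSymbolClass Ω P)
    (hX : IsDerivationOn Ω X) (hY : ∀ {w f}, P w f → P w (Y f))
    (hXY : ∀ f, SmoothOn Ω f → Set.EqOn (X (Y f)) (Y (X f)) Ω) {n : ℕ} {w f : ℝ × ℝ → ℝ}
    (h : StableUpTo X P n w f) : StableUpTo X P n w (Y f) := by
  induction n generalizing f with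
  | zero => exact hY h
  | succ n ih =>
    exact ⟨hY h.1, (hP.stableUpTo hX n).congr (ih h.2) (hXY f (hP.smooth h.1))⟩

end Stable

/-- The region `0 < a < 3/4`, `0 < t < t₀`. -/
def innerCone (t₀ : ℝ) : Set (ℝ × ℝ) := {p | 0 < p.1 ∧ p.1 < 3 / 4 ∧ 0 < p.2 ∧ p.2 < t₀}

theorem isOpen_innerCone (t₀ : ℝ) : IsOpen (innerCone t₀) :=
  (isOpen_lt continuous_const continuous_fst).inter <|
    (isOpen_lt continuous_fst continuous_const).inter <|
      (isOpen_lt continuous_const continuous_snd).inter <|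
        isOpen_lt continuous_snd continuous_const

/-- Functions on the inner cone bounded by `w` along with all their `t ∂_t`-derivatives. -/
def TSymbol (t₀ : ℝ) : (ℝ × ℝ → ℝ) → (ℝ × ℝ → ℝ) → Prop :=
  Stable tDeriv (BoundedBy (innerCone t₀))

/-- Functions on the inner cone bounded by `w` along with all their derivatives under `t ∂_t`
and `a ∂_a`. -/
def ConeSymbol (t₀ : ℝ) : (ℝ × ℝ → ℝ) → (ℝ × ℝ → ℝ) → Prop :=
  Stable aDeriv (TSymbol t₀)

theorem isSymbolClass_tSymbol (t₀ : ℝ) : IsSymbolClass (innerCone t₀) (TSymbol t₀) :=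
  (isSymbolClass_boundedBy _).stable (isDerivationOn_tDeriv (isOpen_innerCone t₀))

theorem isSymbolClass_coneSymbol (t₀ : ℝ) : IsSymbolClass (innerCone t₀) (ConeSymbol t₀) :=
  (isSymbolClass_tSymbol t₀).stable (isDerivationOn_aDeriv (isOpen_innerCone t₀))

theorem aDeriv_tDeriv_comm (t₀ : ℝ) (f : ℝ × ℝ → ℝ) (hf : SmoothOn (innerCone t₀) f) :
    Set.EqOn (aDeriv (tDeriv f)) (tDeriv (aDeriv f)) (innerCone t₀) := fun p hp => by
  rw [aDeriv_tDeriv (isOpen_innerCone t₀) hf hp, tDeriv_aDeriv (isOpen_innerCone t₀) hf hp]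

theorem ConeSymbol.stableUpTo_tDeriv {t₀ : ℝ} {n : ℕ} {w f : ℝ × ℝ → ℝ}
    (h : StableUpTo aDeriv (TSymbol t₀) n w f) :
    StableUpTo aDeriv (TSymbol t₀) n w (tDeriv f) :=
  (isSymbolClass_tSymbol t₀).stableUpTo_comm (isDerivationOn_aDeriv (isOpen_innerCone t₀))
    Stable.deriv (aDeriv_tDeriv_comm t₀) h

theorem ConeSymbol.tDeriv {t₀ : ℝ} {w f : ℝ × ℝ → ℝ} (h : ConeSymbol t₀ w f) :
    ConeSymbol t₀ w (tDeriv f) := fun n => ConeSymbol.stableUpTo_tDeriv (h n)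

theorem ConeSymbol.of_deriv_eq_mul {t₀ : ℝ} {w f α β : ℝ × ℝ → ℝ}
    (h0 : BoundedBy (innerCone t₀) w f) (hα : ConeSymbol t₀ 1 α) (hβ : TSymbol t₀ 1 β)
    (ha : Set.EqOn (aDeriv f) (α * f) (innerCone t₀))
    (ht : Set.EqOn (_root_.tDeriv f) (β * f) (innerCone t₀)) : ConeSymbol t₀ w f :=
  (isSymbolClass_tSymbol t₀).stable_of_deriv_eq_mul
    (isDerivationOn_aDeriv (isOpen_innerCone t₀))
    ((isSymbolClass_boundedBy _).stable_of_deriv_eq_mul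
      (isDerivationOn_tDeriv (isOpen_innerCone t₀)) h0 hβ ht) hα ha

theorem ConeSymbol.of_aDeriv_eq_zero {t₀ : ℝ} {w f : ℝ × ℝ → ℝ}
    (h0 : TSymbol t₀ w f)
    (ha : Set.EqOn (aDeriv f) 0 (innerCone t₀)) : ConeSymbol t₀ w f :=
  (isSymbolClass_tSymbol t₀).stable_of_deriv_eq_zero
    (isDerivationOn_aDeriv (isOpen_innerCone t₀)) h0 ha

theorem ConeSymbol.const (t₀ c : ℝ) : ConeSymbol t₀ 1 (fun _ => c) :=
  ConeSymbol.of_aDeriv_eq_zero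
    ((isSymbolClass_boundedBy _).stable_of_deriv_eq_zero
      (isDerivationOn_tDeriv (isOpen_innerCone t₀))
      ⟨contDiffOn_const, |c|, fun _ _ => by simp⟩
      ((isDerivationOn_tDeriv (isOpen_innerCone t₀)).const c))
    ((isDerivationOn_aDeriv (isOpen_innerCone t₀)).const c)

theorem ConeSymbol.sub {t₀ : ℝ} {w f g : ℝ × ℝ → ℝ} (hf : ConeSymbol t₀ w f)
    (hg : ConeSymbol t₀ w g) : ConeSymbol t₀ w (f - g) := by
  have := (isSymbolClass_coneSymbol t₀).add hf
    ((isSymbolClass_coneSymbol t₀).one_mul (ConeSymbol.const t₀ (-1)) hg)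
  convert this using 1
  ext p
  simp
  ring

theorem hasDerivAt_slice_fst {f : ℝ × ℝ → ℝ} {a t : ℝ} (hf : DifferentiableAt ℝ f (a, t)) :
    HasDerivAt (fun a' => f (a', t)) (dirDeriv (1, 0) f (a, t)) a :=
  HasFDerivAt.comp_hasDerivAt a hf.hasFDerivAt
    ((hasDerivAt_id a).prodMk (hasDerivAt_const a t))

theorem hasDerivAt_slice_snd {f : ℝ × ℝ → ℝ} {a t : ℝ} (hf : DifferentiableAt ℝ f (a, t)) :
    HasDerivAt (fun t' => f (a, t')) (dirDeriv (0, 1) f (a, t)) t :=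
  HasFDerivAt.comp_hasDerivAt t hf.hasFDerivAt
    ((hasDerivAt_const t a).prodMk (hasDerivAt_id t))

theorem SmoothOn.iterate {Ω : Set (ℝ × ℝ)} {X : (ℝ × ℝ → ℝ) → ℝ × ℝ → ℝ}
    (hX : ∀ {f}, SmoothOn Ω f → SmoothOn Ω (X f)) {f : ℝ × ℝ → ℝ} (hf : SmoothOn Ω f) (m : ℕ) :
    SmoothOn Ω (X^[m] f) := by
  induction m with
  | zero => exact hf
  | succ m ih => rw [Function.iterate_succ_apply']; exact hX ih

theorem IsDerivationOn.smooth_iterate {Ω : Set (ℝ × ℝ)} {X : (ℝ × ℝ → ℝ) → ℝ × ℝ → ℝ}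
    (hX : IsDerivationOn Ω X) {f : ℝ × ℝ → ℝ} (hf : SmoothOn Ω f) (m : ℕ) :
    SmoothOn Ω (X^[m] f) :=
  hf.iterate hX.smooth m

/-- If composing with a curve turns `X` into `d/ds`, then iterated derivatives along the curve are
iterates of `X`. -/
theorem iteratedDeriv_comp_curve {Ω : Set (ℝ × ℝ)} {X : (ℝ × ℝ → ℝ) → ℝ × ℝ → ℝ}
    (hX : ∀ {f}, SmoothOn Ω f → SmoothOn Ω (X f)) {γ : ℝ → ℝ × ℝ} {U : Set ℝ} (hU : IsOpen U)
    (h : ∀ g, SmoothOn Ω g → ∀ s ∈ U, HasDerivAt (fun s' => g (γ s')) (X g (γ s)) s)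
    {f : ℝ × ℝ → ℝ} (hf : SmoothOn Ω f) (n : ℕ) {s : ℝ} (hs : s ∈ U) :
    iteratedDeriv n (fun s' => f (γ s')) s = X^[n] f (γ s) := by
  induction n generalizing s with
  | zero => simp
  | succ n ih =>
    have : iteratedDeriv n (fun s' => f (γ s')) =ᶠ[nhds s] fun s' => X^[n] f (γ s') := by
      filter_upwards [hU.mem_nhds hs] with s' hs' using ih hs'
    rw [iteratedDeriv_succ, this.deriv_eq, Function.iterate_succ_apply',
      (h _ (hf.iterate hX n) s hs).deriv]

theorem pdat_eq_dirDeriv {Ω : Set (ℝ × ℝ)} (hΩ : IsOpen Ω) {q : ℝ → ℝ → ℝ}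
    (hq : SmoothOn Ω (fun p => q p.1 p.2)) (ℓ k : ℕ) {a t : ℝ} (hp : (a, t) ∈ Ω) :
    pdat ℓ k q a t
      = (dirDeriv (1, 0))^[ℓ] ((dirDeriv (0, 1))^[k] (fun p => q p.1 p.2)) (a, t) := by
  have inner : ∀ a', (a', t) ∈ Ω → iteratedDeriv k (fun t' => q a' t') t
      = (dirDeriv (0, 1))^[k] (fun p => q p.1 p.2) (a', t) := fun a' ha' =>
    iteratedDeriv_comp_curve (isDerivationOn_dirDeriv hΩ _).smooth (γ := fun t' => (a', t'))
      (hΩ.preimage (by fun_prop : Continuous fun t' : ℝ => (a', t')))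
      (fun g hg s hs => hasDerivAt_slice_snd (hg.differentiableAt hΩ hs)) hq k ha'
  have hU : IsOpen {a' : ℝ | (a', t) ∈ Ω} :=
    hΩ.preimage (by fun_prop : Continuous fun a' : ℝ => (a', t))
  have : (fun a' => iteratedDeriv k (fun t' => q a' t') t) =ᶠ[nhds a]
      fun a' => (dirDeriv (0, 1))^[k] (fun p => q p.1 p.2) (a', t) := by
    filter_upwards [hU.mem_nhds hp] with a' ha' using inner a' ha'
  rw [pdat, this.iteratedDeriv_eq]
  exact iteratedDeriv_comp_curve (isDerivationOn_dirDeriv hΩ _).smooth (γ := fun a' => (a', t)) hU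
    (fun g hg s hs => hasDerivAt_slice_fst (hg.differentiableAt hΩ hs))
    ((isDerivationOn_dirDeriv hΩ _).smooth_iterate hq k) ℓ hp

theorem dirDeriv_iterate_comm {Ω : Set (ℝ × ℝ)} (hΩ : IsOpen Ω) {f : ℝ × ℝ → ℝ}
    (hf : SmoothOn Ω f) (v w : ℝ × ℝ) (k : ℕ) :
    Set.EqOn (dirDeriv v ((dirDeriv w)^[k] f)) ((dirDeriv w)^[k] (dirDeriv v f)) Ω := by
  induction k with
  | zero => exact fun _ _ => rfl
  | succ k ih =>
    rw [Function.iterate_succ_apply', Function.iterate_succ_apply']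
    exact (dirDeriv_comm hΩ ((isDerivationOn_dirDeriv hΩ w).smooth_iterate hf k) v w).trans
      ((isDerivationOn_dirDeriv hΩ w).congr ih)

theorem dirDeriv_iterate_iterate_comm {Ω : Set (ℝ × ℝ)} (hΩ : IsOpen Ω) {f : ℝ × ℝ → ℝ}
    (hf : SmoothOn Ω f) (v w : ℝ × ℝ) (ℓ k : ℕ) :
    Set.EqOn ((dirDeriv v)^[ℓ] ((dirDeriv w)^[k] f)) ((dirDeriv w)^[k] ((dirDeriv v)^[ℓ] f)) Ω := by
  induction ℓ with
  | zero => exact fun _ _ => rfl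
  | succ ℓ ih =>
    rw [Function.iterate_succ_apply', Function.iterate_succ_apply']
    exact ((isDerivationOn_dirDeriv hΩ v).congr ih).trans
      (dirDeriv_iterate_comm hΩ ((isDerivationOn_dirDeriv hΩ v).smooth_iterate hf ℓ) v w k)

theorem dirDeriv_iterate_tDeriv {Ω : Set (ℝ × ℝ)} (hΩ : IsOpen Ω) {f : ℝ × ℝ → ℝ}
    (hf : SmoothOn Ω f) (k : ℕ) {p : ℝ × ℝ} (hp : p ∈ Ω) :
    (dirDeriv (0, 1))^[k] (tDeriv f) p
      = p.2 * (dirDeriv (0, 1))^[k + 1] f p + k * (dirDeriv (0, 1))^[k] f p := by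
  have hX := isDerivationOn_dirDeriv hΩ ((0, 1) : ℝ × ℝ)
  induction k generalizing p with
  | zero => simp [tDeriv]
  | succ k ih =>
    have e : Set.EqOn ((dirDeriv (0, 1))^[k] (tDeriv f))
        (Prod.snd * (dirDeriv (0, 1))^[k + 1] f
          + (fun _ => (k : ℝ)) * (dirDeriv (0, 1))^[k] f) Ω := fun p hp => ih hp
    have hs := hX.smooth_iterate hf
    have hk : SmoothOn Ω (fun _ => (k : ℝ)) := contDiffOn_const
    have h1 := hX.mul (f := Prod.snd) contDiffOn_snd (hs (k + 1)) hp
    have h2 := hX.mul hk (hs k) hp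
    have h3 := hX.add (f := Prod.snd * (dirDeriv (0, 1))^[k + 1] f)
      (g := (fun _ => (k : ℝ)) * (dirDeriv (0, 1))^[k] f)
      (SmoothOn.mul contDiffOn_snd (hs (k + 1))) (hk.mul (hs k)) hp
    have h4 := hX.const k hp
    rw [Function.iterate_succ_apply', hX.congr e hp, h3, Pi.add_apply, h1, h2]
    simp only [Pi.add_apply, Pi.mul_apply, dirDeriv_snd, h4, Function.iterate_succ_apply',
      Pi.zero_apply]
    push_cast
    ring

theorem TSymbol.of_forall_dirDeriv {t₀ : ℝ} {w f : ℝ × ℝ → ℝ}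
    (hf : SmoothOn (innerCone t₀) f)
    (h : ∀ k, ∃ C : ℝ, ∀ p ∈ innerCone t₀,
      |(dirDeriv (0, 1))^[k] f p| ≤ C * (p.2 ^ k)⁻¹ * w p) : TSymbol t₀ w f := by
  intro n
  induction n generalizing f with
  | zero =>
    obtain ⟨C, hC⟩ := h 0
    exact ⟨hf, C, fun p hp => by simpa using hC p hp⟩
  | succ n ih =>
    refine ⟨⟨hf, ?_⟩, ih ((isDerivationOn_tDeriv (isOpen_innerCone t₀)).smooth hf) fun k => ?_⟩
    · obtain ⟨C, hC⟩ := h 0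
      exact ⟨C, fun p hp => by simpa using hC p hp⟩
    · obtain ⟨C, hC⟩ := h k
      obtain ⟨C', hC'⟩ := h (k + 1)
      refine ⟨C' + k * C, fun p hp => ?_⟩
      have ht : 0 < p.2 := hp.2.2.1
      rw [dirDeriv_iterate_tDeriv (isOpen_innerCone t₀) hf k hp]
      calc |p.2 * (dirDeriv (0, 1))^[k + 1] f p + k * (dirDeriv (0, 1))^[k] f p|
          ≤ p.2 * |(dirDeriv (0, 1))^[k + 1] f p| + k * |(dirDeriv (0, 1))^[k] f p| := by
            refine (abs_add_le _ _).trans_eq ?_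
            rw [abs_mul, abs_mul, abs_of_pos ht, Nat.abs_cast]
        _ ≤ p.2 * (C' * (p.2 ^ (k + 1))⁻¹ * w p) + k * (C * (p.2 ^ k)⁻¹ * w p) := by
            gcongr
            · exact hC' p hp
            · exact hC p hp
        _ = (C' + k * C) * (p.2 ^ k)⁻¹ * w p := by
            rw [pow_succ]
            field_simp

theorem aDeriv_comp_fst {g : ℝ → ℝ} {g' : ℝ} {p : ℝ × ℝ} (h : HasDerivAt g g' p.1) :
    aDeriv (fun p => g p.1) p = p.1 * g' := by
  have := (h.comp_hasFDerivAt p (hasFDerivAt_fst (𝕜 := ℝ))).fderiv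
  simp only [Function.comp_def] at this
  simp [aDeriv, dirDeriv, this]

theorem tDeriv_comp_fst {g : ℝ → ℝ} {g' : ℝ} {p : ℝ × ℝ} (h : HasDerivAt g g' p.1) :
    tDeriv (fun p => g p.1) p = 0 := by
  have := (h.comp_hasFDerivAt p (hasFDerivAt_fst (𝕜 := ℝ))).fderiv
  simp only [Function.comp_def] at this
  simp [tDeriv, dirDeriv, this]

theorem tDeriv_comp_snd {g : ℝ → ℝ} {g' : ℝ} {p : ℝ × ℝ} (h : HasDerivAt g g' p.2) :
    tDeriv (fun p => g p.2) p = p.2 * g' := by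
  have := (h.comp_hasFDerivAt p (hasFDerivAt_snd (𝕜 := ℝ))).fderiv
  simp only [Function.comp_def] at this
  simp [tDeriv, dirDeriv, this]

theorem aDeriv_comp_snd {g : ℝ → ℝ} {g' : ℝ} {p : ℝ × ℝ} (h : HasDerivAt g g' p.2) :
    aDeriv (fun p => g p.2) p = 0 := by
  have := (h.comp_hasFDerivAt p (hasFDerivAt_snd (𝕜 := ℝ))).fderiv
  simp only [Function.comp_def] at this
  simp [aDeriv, dirDeriv, this]

theorem SmoothOn.comp_snd {t₀ : ℝ} {g : ℝ → ℝ} (hg : ContDiffOn ℝ (⊤ : ℕ∞) g (Set.Ioo 0 t₀)) :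
    SmoothOn (innerCone t₀) (fun p => g p.2) :=
  hg.comp contDiffOn_snd fun _ hp => ⟨hp.2.2.1, hp.2.2.2⟩

theorem ConeSymbol.fst (t₀ : ℝ) : ConeSymbol t₀ Prod.fst Prod.fst := by
  refine ConeSymbol.of_deriv_eq_mul (α := fun _ => 1) (β := fun _ => 0)
    ⟨contDiffOn_fst, 1, fun p hp => ?_⟩ (ConeSymbol.const t₀ 1) (ConeSymbol.const t₀ 0).base ?_ ?_
  · rw [abs_of_pos hp.1, _root_.one_mul]
  · intro p _
    simpa using aDeriv_comp_fst (p := p) (hasDerivAt_id p.1)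
  · intro p _
    simpa using tDeriv_comp_fst (p := p) (hasDerivAt_id p.1)

theorem ConeSymbol.fst_one (t₀ : ℝ) : ConeSymbol t₀ 1 Prod.fst :=
  (isSymbolClass_coneSymbol t₀).mono (ConeSymbol.fst t₀) fun p hp =>
    ⟨hp.1.le, hp.2.1.le.trans (by norm_num)⟩

theorem ConeSymbol.inv_fst (t₀ : ℝ) :
    ConeSymbol t₀ (fun p => p.1⁻¹) (fun p => p.1⁻¹) := by
  refine ConeSymbol.of_deriv_eq_mul (α := fun _ => -1) (β := fun _ => 0)
    ⟨contDiffOn_fst.inv fun p hp => hp.1.ne', 1, fun p hp => ?_⟩ (ConeSymbol.const t₀ (-1))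
    (ConeSymbol.const t₀ 0).base ?_ ?_
  · rw [abs_of_pos (inv_pos.2 hp.1), _root_.one_mul]
  · intro p hp
    have h0 : p.1 ≠ 0 := hp.1.ne'
    rw [aDeriv_comp_fst (hasDerivAt_inv h0), Pi.mul_apply]
    field_simp
  · intro p hp
    rw [tDeriv_comp_fst (hasDerivAt_inv hp.1.ne'), Pi.mul_apply, zero_mul]

theorem ConeSymbol.inv_one_sub_sq (t₀ : ℝ) : ConeSymbol t₀ 1 (fun p => (1 - p.1 ^ 2)⁻¹) := by
  have hpos : ∀ p ∈ innerCone t₀, 0 < 1 - p.1 ^ 2 := fun p hp => by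
    nlinarith [hp.1, hp.2.1]
  have hd : ∀ p ∈ innerCone t₀, HasDerivAt (fun a : ℝ => (1 - a ^ 2)⁻¹)
      (2 * p.1 / (1 - p.1 ^ 2) ^ 2) p.1 := fun p hp => by
    have h := ((hasDerivAt_pow 2 p.1).const_sub 1).inv (hpos p hp).ne'
    exact h.congr_deriv (by simp)
  have hT : TSymbol t₀ 1 (fun p => (1 - p.1 ^ 2)⁻¹) := by
    refine (isSymbolClass_boundedBy _).stable_of_deriv_eq_zero
      (isDerivationOn_tDeriv (isOpen_innerCone t₀)) ⟨?_, 3, fun p hp => ?_⟩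
      fun p hp => tDeriv_comp_fst (hd p hp)
    · exact (contDiffOn_const.sub (contDiffOn_fst.pow 2)).inv fun p hp => (hpos p hp).ne'
    · rw [abs_of_pos (inv_pos.2 (hpos p hp)), Pi.one_apply, mul_one]
      refine inv_le_of_inv_le₀ (by norm_num) ?_
      nlinarith [hp.1, hp.2.1]
  refine stable_of_step hT fun n hn => ?_
  have hP := (isSymbolClass_tSymbol t₀).stableUpTo
    (isDerivationOn_aDeriv (isOpen_innerCone t₀)) n
  refine hP.congr (hP.one_mul (ConeSymbol.const t₀ 2 n) (hP.one_mul
    (hP.one_mul (ConeSymbol.fst_one t₀ n) (ConeSymbol.fst_one t₀ n)) (hP.one_mul hn hn)))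
    fun p hp => ?_
  rw [aDeriv_comp_fst (hd p hp)]
  simp only [Pi.mul_apply]
  have := (hpos p hp).ne'
  field_simp

theorem ConeSymbol.cos_log (t₀ : ℝ) :
    ConeSymbol t₀ 1 (fun p => Real.cos (Real.log p.2)) := by
  have hc : ∀ p ∈ innerCone t₀, HasDerivAt (fun t => Real.cos (Real.log t))
      (-Real.sin (Real.log p.2) * p.2⁻¹) p.2 := fun p hp =>
    (Real.hasDerivAt_log hp.2.2.1.ne').cos
  have hs : ∀ p ∈ innerCone t₀, HasDerivAt (fun t => -Real.sin (Real.log t))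
      (-(Real.cos (Real.log p.2) * p.2⁻¹)) p.2 := fun p hp =>
    (Real.hasDerivAt_log hp.2.2.1.ne').sin.neg
  have hΩ := isOpen_innerCone t₀
  have hX := isDerivationOn_tDeriv hΩ
  have hB := isSymbolClass_boundedBy (innerCone t₀)
  have hlog : SmoothOn (innerCone t₀) (fun p => Real.log p.2) :=
    contDiffOn_snd.log fun p hp => hp.2.2.1.ne'
  have e1 : Set.EqOn (_root_.tDeriv (fun p => Real.cos (Real.log p.2)))
      (fun p => -Real.sin (Real.log p.2)) (innerCone t₀) := fun p hp => by
    have : p.2 ≠ 0 := hp.2.2.1.ne'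
    rw [tDeriv_comp_snd (hc p hp)]
    field_simp
  have e2 : Set.EqOn (_root_.tDeriv (fun p => -Real.sin (Real.log p.2)))
      ((fun _ => -1) * fun p => Real.cos (Real.log p.2)) (innerCone t₀) := fun p hp => by
    have : p.2 ≠ 0 := hp.2.2.1.ne'
    rw [tDeriv_comp_snd (hs p hp), Pi.mul_apply]
    field_simp
  refine ConeSymbol.of_aDeriv_eq_zero (stable_of_two_step
    ⟨ContDiffOn.cos hlog, 1, fun p _ => by simpa using Real.abs_cos_le_one _⟩
    (hB.congr ⟨(ContDiffOn.sin hlog).neg, 1, fun p _ => by simpa using Real.abs_sin_le_one _⟩ e1)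
    fun n hn => ?_) fun p hp => aDeriv_comp_snd (hc p hp)
  have hP := hB.stableUpTo hX n
  exact hP.congr (hP.one_mul ((ConeSymbol.const t₀ (-1)).base n) hn.of_succ)
    ((hX.congr e1).trans e2)

/-- A positive function of `t` whose logarithmic derivative in `log t` is a symbol is a symbol with
itself as weight. -/
theorem ConeSymbol.of_logDeriv {t₀ : ℝ} {g : ℝ → ℝ} {γ : ℝ → ℝ}
    (hg : ContDiffOn ℝ (⊤ : ℕ∞) g (Set.Ioo 0 t₀)) (hpos : ∀ t, 0 < t → 0 < g t)
    (hd : ∀ t, 0 < t → HasDerivAt g (γ t * g t / t) t)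
    (hγ : ConeSymbol t₀ 1 (fun p => γ p.2)) :
    ConeSymbol t₀ (fun p => g p.2) (fun p => g p.2) := by
  refine ConeSymbol.of_deriv_eq_mul (α := fun _ => 0)
    ⟨SmoothOn.comp_snd hg, 1, fun p hp => ?_⟩ (ConeSymbol.const t₀ 0) hγ.base ?_ ?_
  · rw [abs_of_pos (hpos _ hp.2.2.1), _root_.one_mul]
  · intro p hp
    rw [aDeriv_comp_snd (hd p.2 hp.2.2.1), Pi.mul_apply, zero_mul]
  · intro p hp
    have : p.2 ≠ 0 := hp.2.2.1.ne'
    rw [tDeriv_comp_snd (hd p.2 hp.2.2.1), Pi.mul_apply]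
    field_simp

theorem ConeSymbol.inv_snd (t₀ : ℝ) :
    ConeSymbol t₀ (fun p => p.2⁻¹) (fun p => p.2⁻¹) := by
  refine ConeSymbol.of_logDeriv (g := fun t => t⁻¹) (γ := fun _ => -1)
    (contDiffOn_id.inv fun t ht => ht.1.ne') (fun t ht => inv_pos.2 ht) (fun t ht => ?_)
    (ConeSymbol.const t₀ (-1))
  exact (hasDerivAt_inv ht.ne').congr_deriv (by field_simp)

theorem lam_pos (ν ε₀ : ℝ) {t : ℝ} (ht : 0 < t) : 0 < lam ν ε₀ t :=
  mul_pos (Real.rpow_pos_of_pos ht _) (Real.exp_pos _)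

theorem hasDerivAt_lam (ν ε₀ : ℝ) {t : ℝ} (ht : 0 < t) :
    HasDerivAt (lam ν ε₀) ((-1 - ν - ε₀ * Real.cos (Real.log t)) * lam ν ε₀ t / t) t := by
  have h1 : HasDerivAt (fun t : ℝ => t ^ (-1 - ν)) ((-1 - ν) * t ^ (-1 - ν - 1)) t :=
    Real.hasDerivAt_rpow_const (Or.inl ht.ne')
  have h2 := (((Real.hasDerivAt_log ht.ne').sin).const_mul (-ε₀)).exp
  refine (h1.mul h2).congr_deriv ?_
  rw [Real.rpow_sub_one ht.ne', lam]
  field_simp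
  ring

theorem contDiffOn_lam (ν ε₀ t₀ : ℝ) : ContDiffOn ℝ (⊤ : ℕ∞) (lam ν ε₀) (Set.Ioo 0 t₀) :=
  (contDiffOn_id.rpow_const_of_ne fun _ ht => ht.1.ne').mul
    (contDiffOn_const.mul (contDiffOn_id.log fun _ ht => ht.1.ne').sin).exp

theorem ConeSymbol.lam_rpow (ν ε₀ t₀ s : ℝ) :
    ConeSymbol t₀ (fun p => lam ν ε₀ p.2 ^ s) (fun p => lam ν ε₀ p.2 ^ s) := by
  refine ConeSymbol.of_logDeriv (g := fun t => lam ν ε₀ t ^ s)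
    (γ := fun t => s * (-1 - ν - ε₀ * Real.cos (Real.log t)))
    ((contDiffOn_lam ν ε₀ t₀).rpow_const_of_ne fun t ht => (lam_pos ν ε₀ ht.1).ne')
    (fun t ht => Real.rpow_pos_of_pos (lam_pos ν ε₀ ht) _) (fun t ht => ?_) ?_
  · have hl := lam_pos ν ε₀ ht
    convert (hasDerivAt_lam ν ε₀ ht).rpow_const (p := s) (Or.inl hl.ne') using 1
    rw [Real.rpow_sub_one hl.ne']
    field_simp
  · have hP := isSymbolClass_coneSymbol t₀
    exact hP.one_mul (ConeSymbol.const t₀ s) (ConeSymbol.sub (ConeSymbol.const t₀ (-1 - ν))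
      (hP.one_mul (ConeSymbol.const t₀ ε₀) (ConeSymbol.cos_log t₀)))

theorem ConeSymbol.inv_mu (ν ε₀ t₀ : ℝ) :
    ConeSymbol t₀ (fun p => (mu ν ε₀ p.2)⁻¹) (fun p => (mu ν ε₀ p.2)⁻¹) := by
  have h := (isSymbolClass_coneSymbol t₀).mul (ConeSymbol.inv_snd t₀)
    (ConeSymbol.lam_rpow ν ε₀ t₀ (-1))
  have e : (fun p : ℝ × ℝ => (mu ν ε₀ p.2)⁻¹)
      = (fun p => p.2⁻¹) * fun p => (lam ν ε₀ p.2)⁻¹ := by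
    ext p
    simp [mu, mul_comm]
  rw [e]
  simpa only [Real.rpow_neg_one] using h

theorem ConeSymbol.betaJ (ν ε₀ t₀ : ℝ) (j : ℕ) :
    ConeSymbol t₀ 1 (fun p => betaJ ν ε₀ j p.2) := by
  have hP := isSymbolClass_coneSymbol t₀
  exact ConeSymbol.sub (hP.one_mul (ConeSymbol.const t₀ ((j : ℝ) - 1 / 2))
    (hP.add (ConeSymbol.const t₀ ν) (hP.one_mul (ConeSymbol.const t₀ ε₀) (ConeSymbol.cos_log t₀))))
    (ConeSymbol.const t₀ (1 / 2))

theorem ConeSymbol.of_iteratedDeriv_snd {t₀ : ℝ} {c : ℝ → ℝ}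
    (hc : ContDiffOn ℝ (⊤ : ℕ∞) c (Set.Ioo 0 t₀))
    (h : ∀ k : ℕ, ∃ C : ℝ, ∀ t : ℝ, 0 < t → t < t₀ → |iteratedDeriv k c t| ≤ C * (t ^ k)⁻¹) :
    ConeSymbol t₀ 1 (fun p => c p.2) := by
  have hΩ := isOpen_innerCone t₀
  have hsm := SmoothOn.comp_snd hc
  refine ConeSymbol.of_aDeriv_eq_zero (TSymbol.of_forall_dirDeriv hsm fun k => ?_)
    fun p hp => aDeriv_comp_snd
      ((hc.contDiffAt (isOpen_Ioo.mem_nhds ⟨hp.2.2.1, hp.2.2.2⟩)).differentiableAt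
        (by simp)).hasDerivAt
  obtain ⟨C, hC⟩ := h k
  refine ⟨C, fun p hp => ?_⟩
  have := iteratedDeriv_comp_curve (isDerivationOn_dirDeriv hΩ (0, 1)).smooth
    (γ := fun t' => (p.1, t')) (hΩ.preimage (by fun_prop : Continuous fun t' : ℝ => (p.1, t')))
    (fun g hg s hs => hasDerivAt_slice_snd (hg.differentiableAt hΩ hs)) hsm k (s := p.2) hp
  rw [← this, Pi.one_apply, mul_one]
  exact hC p.2 hp.2.2.1 hp.2.2.2

/-- A solution of a second order equation in `a` with symbol coefficients, whose first two
`a`-derivatives are controlled together with all their `t`-derivatives, is a symbol. -/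
theorem ConeSymbol.of_second_order_eq {t₀ : ℝ} {w q g e₀ e₁ e₂ e₃ e₄ : ℝ × ℝ → ℝ}
    (h0 : TSymbol t₀ w q) (h1 : TSymbol t₀ w (aDeriv q)) (hg : ConeSymbol t₀ w g)
    (he₀ : ConeSymbol t₀ 1 e₀) (he₁ : ConeSymbol t₀ 1 e₁) (he₂ : ConeSymbol t₀ 1 e₂)
    (he₃ : ConeSymbol t₀ 1 e₃) (he₄ : ConeSymbol t₀ 1 e₄)
    (heq : Set.EqOn (aDeriv (aDeriv q)) (g + e₀ * q + e₁ * aDeriv q + e₂ * _root_.tDeriv q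
      + e₃ * _root_.tDeriv (_root_.tDeriv q) + e₄ * _root_.tDeriv (aDeriv q)) (innerCone t₀)) :
    ConeSymbol t₀ w q := by
  refine stable_of_two_step h0 h1 fun n hn => ?_
  have hP := (isSymbolClass_tSymbol t₀).stableUpTo
    (isDerivationOn_aDeriv (isOpen_innerCone t₀)) n
  have hT := ConeSymbol.stableUpTo_tDeriv hn.of_succ
  exact hP.congr (hP.add (hP.add (hP.add (hP.add (hP.add (hg n) (hP.one_mul (he₀ n) hn.of_succ))
    (hP.one_mul (he₁ n) hn.2)) (hP.one_mul (he₂ n) hT))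
    (hP.one_mul (he₃ n) (ConeSymbol.stableUpTo_tDeriv hT)))
    (hP.one_mul (he₄ n) (ConeSymbol.stableUpTo_tDeriv hn.2))) heq

theorem ConeSymbol.pow {t₀ : ℝ} {w f : ℝ × ℝ → ℝ} (h : ConeSymbol t₀ w f) (n : ℕ) :
    ConeSymbol t₀ (w ^ n) (f ^ n) := by
  induction n with
  | zero => exact ConeSymbol.const t₀ 1
  | succ n ih => rw [pow_succ, pow_succ]; exact (isSymbolClass_coneSymbol t₀).mul ih h

theorem ConeSymbol.one_pow {t₀ : ℝ} {f : ℝ × ℝ → ℝ} (h : ConeSymbol t₀ 1 f) (n : ℕ) :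
    ConeSymbol t₀ 1 (f ^ n) := by
  simpa using h.pow n

theorem dirDeriv_iterate_of_pdat_bound {t₀ : ℝ} {q : ℝ → ℝ → ℝ}
    (hq : SmoothOn (innerCone t₀) (fun p => q p.1 p.2)) {ℓ n : ℕ}
    (h : ∀ k : ℕ, ∃ C : ℝ, ∀ a t : ℝ, 0 ≤ a → a ≤ 1 → 0 < t → t < t₀ →
      |pdat ℓ k q a t| ≤ C * (t ^ k)⁻¹ * a ^ n) :
    TSymbol t₀ (Prod.fst ^ n) ((dirDeriv (1, 0))^[ℓ] (fun p => q p.1 p.2)) := by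
  have hΩ := isOpen_innerCone t₀
  refine TSymbol.of_forall_dirDeriv ((isDerivationOn_dirDeriv hΩ _).smooth_iterate hq ℓ)
    fun k => ?_
  obtain ⟨C, hC⟩ := h k
  refine ⟨C, fun p hp => ?_⟩
  rw [← dirDeriv_iterate_iterate_comm hΩ hq (1, 0) (0, 1) ℓ k hp, ← pdat_eq_dirDeriv hΩ hq ℓ k hp]
  exact hC p.1 p.2 hp.1.le (hp.2.1.le.trans (by norm_num)) hp.2.2.1 hp.2.2.2

theorem ConeSymbol.of_wave_solution {ν ε₀ t₀ : ℝ} {j : ℕ} (hj : j ∈ ({1, 2} : Set ℕ))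
    {q : ℝ → ℝ → ℝ} {c : ℝ → ℝ} (hq : SmoothOn (innerCone t₀) (fun p => q p.1 p.2))
    (hc : ConeSymbol t₀ 1 (fun p => c p.2))
    (heq : ∀ a t : ℝ, 0 < a → a ≤ 1 → 0 < t → t < t₀ →
      (1 - a ^ 2) * pdat 2 0 q a t
        + (2 * (_root_.betaJ ν ε₀ j t - 1) * a + 2 * a⁻¹) * pdat 1 0 q a t
        + (-(_root_.betaJ ν ε₀ j t) ^ 2 + _root_.betaJ ν ε₀ j t
            - t * deriv (_root_.betaJ ν ε₀ j) t) * q a t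
        - (t ^ 2 * pdat 0 2 q a t + 2 * _root_.betaJ ν ε₀ j t * t * pdat 0 1 q a t)
        + 2 * a * t * pdat 1 1 q a t
        = c t * a ^ (2 - j))
    (hb : ∀ k : ℕ, ∃ C : ℝ, ∀ ℓ : ℕ, ℓ ≤ 2 → ∀ a t : ℝ, 0 ≤ a → a ≤ 1 → 0 < t → t < t₀ →
      |pdat ℓ k q a t| ≤ C * (t ^ k)⁻¹ * a ^ (4 - j - ℓ)) :
    ConeSymbol t₀ (Prod.fst ^ (4 - j)) (fun p => q p.1 p.2) := by
  set f : ℝ × ℝ → ℝ := fun p => q p.1 p.2 with hf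
  have hΩ := isOpen_innerCone t₀
  have hP := isSymbolClass_coneSymbol t₀
  have hj' : 2 + (2 - j) = 4 - j := by rcases hj with rfl | rfl <;> rfl
  have hb' : ∀ ℓ ≤ 2, TSymbol t₀ (Prod.fst ^ (4 - j - ℓ)) ((dirDeriv (1, 0))^[ℓ] f) :=
    fun ℓ hℓ => dirDeriv_iterate_of_pdat_bound hq fun k => by
      obtain ⟨C, hC⟩ := hb k
      exact ⟨C, hC ℓ hℓ⟩
  have h0 : TSymbol t₀ (Prod.fst ^ (4 - j)) f := hb' 0 (by norm_num)
  have h1 : TSymbol t₀ (Prod.fst ^ (4 - j)) (aDeriv f) := by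
    have := (isSymbolClass_tSymbol t₀).mul (ConeSymbol.fst t₀).base (hb' 1 (by norm_num))
    rwa [← pow_succ', show 4 - j - 1 + 1 = 4 - j by omega] at this
  have hh := ConeSymbol.inv_one_sub_sq t₀
  have ha := (ConeSymbol.fst_one t₀).one_pow 2
  have hβ := ConeSymbol.betaJ ν ε₀ t₀ j
  set β : ℝ × ℝ → ℝ := fun p => _root_.betaJ ν ε₀ j p.2
  set H : ℝ × ℝ → ℝ := fun p => (1 - p.1 ^ 2)⁻¹
  have hk := ConeSymbol.const t₀
  refine ConeSymbol.of_second_order_eq h0 h1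
    (g := H * ((fun p => c p.2) * Prod.fst ^ (4 - j)))
    (e₀ := H * (Prod.fst ^ 2 * (β * β - β + _root_.tDeriv β)))
    (e₁ := (fun _ => 1) - H * ((fun _ => 2) * ((β - fun _ => 1) * Prod.fst ^ 2) + fun _ => 2))
    (e₂ := H * (Prod.fst ^ 2 * ((fun _ => 2) * β - fun _ => 1)))
    (e₃ := H * Prod.fst ^ 2) (e₄ := (fun _ => -2) * (H * Prod.fst ^ 2))
    (hP.one_mul hh (hP.one_mul hc ((ConeSymbol.fst t₀).pow _)))
    (hP.one_mul hh (hP.one_mul ha (hP.add ((hP.one_mul hβ hβ).sub hβ) hβ.tDeriv)))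
    ((hk 1).sub (hP.one_mul hh
      (hP.add (hP.one_mul (hk 2) (hP.one_mul (hβ.sub (hk 1)) ha)) (hk 2))))
    (hP.one_mul hh (hP.one_mul ha ((hP.one_mul (hk 2) hβ).sub (hk 1))))
    (hP.one_mul hh ha) (hP.one_mul (hk (-2)) (hP.one_mul hh ha)) fun p hp => ?_
  have e := heq p.1 p.2 hp.1 (hp.2.1.le.trans (by norm_num)) hp.2.2.1 hp.2.2.2
  have hne : (1 - p.1 ^ 2) ≠ 0 := by nlinarith [hp.1, hp.2.1]
  have ha0 : p.1 ≠ 0 := hp.1.ne'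
  have hTβ : _root_.tDeriv β p = p.2 * deriv (_root_.betaJ ν ε₀ j) p.2 := by
    refine tDeriv_comp_snd (DifferentiableAt.hasDerivAt ?_)
    have : p.2 ≠ 0 := hp.2.2.1.ne'
    unfold _root_.betaJ
    fun_prop (disch := assumption)
  have hpd : ∀ ℓ k, pdat ℓ k q p.1 p.2 = (dirDeriv (1, 0))^[ℓ] ((dirDeriv (0, 1))^[k] f) p :=
    fun ℓ k => pdat_eq_dirDeriv hΩ hq ℓ k hp
  simp only [hpd, Function.iterate_succ, Function.iterate_zero, Function.comp_apply, id_eq] at e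
  simp only [Pi.add_apply, Pi.mul_apply, Pi.sub_apply, Pi.pow_apply, hTβ,
    aDeriv_aDeriv hΩ hq hp, tDeriv_tDeriv hΩ hq hp, tDeriv_aDeriv hΩ hq hp]
  simp only [aDeriv, _root_.tDeriv, Pi.mul_apply, H, β, ← hj', pow_add]
  have hH : (1 - p.1 ^ 2)⁻¹ * (1 - p.1 ^ 2) = 1 := inv_mul_cancel₀ hne
  have hA : p.1 * p.1⁻¹ = 1 := mul_inv_cancel₀ ha0
  linear_combination (1 - p.1 ^ 2)⁻¹ * p.1 ^ 2 * e
    - p.1 ^ 2 * dirDeriv (1, 0) (dirDeriv (1, 0) f) p * hH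
    - 2 * (1 - p.1 ^ 2)⁻¹ * p.1 * dirDeriv (1, 0) f p * hA

/-- `∂_r` acting on functions of `(r / t, t)`, in the coordinates `(a, t)`. -/
def rField (f : ℝ × ℝ → ℝ) : ℝ × ℝ → ℝ := (fun p => p.1⁻¹ * p.2⁻¹) * aDeriv f

/-- `∂_t` at fixed `r` acting on functions of `(r / t, t)`, in the coordinates `(a, t)`. -/
def tauField (f : ℝ × ℝ → ℝ) : ℝ × ℝ → ℝ := (fun p => p.2⁻¹) * (tDeriv f - aDeriv f)

theorem ConeSymbol.rField_iterate {t₀ : ℝ} {w f : ℝ × ℝ → ℝ} (h : ConeSymbol t₀ w f) (ℓ : ℕ) :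
    ConeSymbol t₀ ((fun p => p.1⁻¹ * p.2⁻¹) ^ ℓ * w) (rField^[ℓ] f) := by
  have hP := isSymbolClass_coneSymbol t₀
  induction ℓ with
  | zero => simpa using h
  | succ ℓ ih =>
    rw [Function.iterate_succ_apply', pow_succ', mul_assoc]
    exact hP.mul (hP.mul (ConeSymbol.inv_fst t₀) (ConeSymbol.inv_snd t₀)) ih.deriv

theorem ConeSymbol.tauField_iterate {t₀ : ℝ} {w f : ℝ × ℝ → ℝ} (h : ConeSymbol t₀ w f) (k : ℕ) :
    ConeSymbol t₀ ((fun p => p.2⁻¹) ^ k * w) (tauField^[k] f) := by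
  have hP := isSymbolClass_coneSymbol t₀
  induction k with
  | zero => simpa using h
  | succ k ih =>
    rw [Function.iterate_succ_apply', pow_succ', mul_assoc]
    exact hP.mul (ConeSymbol.inv_snd t₀) (ih.tDeriv.sub ih.deriv)

theorem SmoothOn.rField {t₀ : ℝ} {f : ℝ × ℝ → ℝ} (hf : SmoothOn (innerCone t₀) f) :
    SmoothOn (innerCone t₀) (rField f) :=
  SmoothOn.mul ((contDiffOn_fst.inv fun _ hp => hp.1.ne').mul
    (contDiffOn_snd.inv fun _ hp => hp.2.2.1.ne'))
    ((isDerivationOn_aDeriv (isOpen_innerCone t₀)).smooth hf)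

theorem SmoothOn.tauField {t₀ : ℝ} {f : ℝ × ℝ → ℝ} (hf : SmoothOn (innerCone t₀) f) :
    SmoothOn (innerCone t₀) (tauField f) :=
  SmoothOn.mul (contDiffOn_snd.inv fun _ hp => hp.2.2.1.ne')
    (((isDerivationOn_tDeriv (isOpen_innerCone t₀)).smooth hf).sub
      ((isDerivationOn_aDeriv (isOpen_innerCone t₀)).smooth hf))

theorem hasDerivAt_rField {t₀ : ℝ} {f : ℝ × ℝ → ℝ} (hf : SmoothOn (innerCone t₀) f) {r t : ℝ}
    (hp : (r / t, t) ∈ innerCone t₀) :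
    HasDerivAt (fun r' => f (r' / t, t)) (rField f (r / t, t)) r := by
  have ha : r / t ≠ 0 := hp.1.ne'
  refine ((hf.differentiableAt (isOpen_innerCone t₀) hp).hasFDerivAt.comp_hasDerivAt r
    (((hasDerivAt_id r).div_const t).prodMk (hasDerivAt_const r t))).congr_deriv ?_
  have : ((1 / t, 0) : ℝ × ℝ) = t⁻¹ • (1, 0) := by simp
  rw [this, map_smul, smul_eq_mul]
  simp only [rField, aDeriv, dirDeriv, Pi.mul_apply]
  rw [mul_comm (r / t)⁻¹, mul_assoc, inv_mul_cancel_left₀ ha]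

theorem hasDerivAt_tauField {t₀ : ℝ} {f : ℝ × ℝ → ℝ} (hf : SmoothOn (innerCone t₀) f) {r t : ℝ}
    (hp : (r / t, t) ∈ innerCone t₀) :
    HasDerivAt (fun t' => f (r / t', t')) (tauField f (r / t, t)) t := by
  have ht : t ≠ 0 := hp.2.2.1.ne'
  refine (HasFDerivAt.comp_hasDerivAt (f := fun t' => (r / t', t')) t
    (hf.differentiableAt (isOpen_innerCone t₀) hp).hasFDerivAt
    (((hasDerivAt_const t r).div (hasDerivAt_id t) ht).prodMk (hasDerivAt_id t))).congr_deriv ?_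
  have : ((((0 : ℝ) * id t - r * 1) / id t ^ 2, 1) : ℝ × ℝ)
      = (-(t⁻¹ * (r / t))) • ((1, 0) : ℝ × ℝ) + (0, 1) := by
    ext
    · simp
      field_simp
    · simp
  rw [this, map_add, map_smul, smul_eq_mul]
  simp only [tauField, aDeriv, tDeriv, dirDeriv, Pi.mul_apply, Pi.sub_apply]
  field_simp
  ring

theorem pd_eq_fields {t₀ : ℝ} {v : ℝ → ℝ → ℝ} {f : ℝ × ℝ → ℝ}
    (hf : SmoothOn (innerCone t₀) f) (hv : ∀ t r, v t r = f (r / t, t)) (k ℓ : ℕ) {t r : ℝ}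
    (ht₀ : t < t₀) (hr : 0 < r) (hrt : r < 3 / 4 * t) :
    pd k ℓ v t r = tauField^[k] (rField^[ℓ] f) (r / t, t) := by
  have hmem : ∀ s ∈ Set.Ioo (4 / 3 * r) t₀, (r / s, s) ∈ innerCone t₀ := fun s hs => by
    have h0 : 0 < s := lt_trans (by positivity) hs.1
    exact ⟨div_pos hr h0, (div_lt_iff₀ h0).2 (by linarith [hs.1]), h0, hs.2⟩
  have ht : t ∈ Set.Ioo (4 / 3 * r) t₀ := ⟨by linarith, ht₀⟩
  have inner : ∀ s ∈ Set.Ioo (4 / 3 * r) t₀,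
      iteratedDeriv ℓ (fun r' => v s r') r = rField^[ℓ] f (r / s, s) := fun s hs => by
    simp only [hv]
    exact iteratedDeriv_comp_curve SmoothOn.rField (γ := fun r' => (r' / s, s))
      ((isOpen_innerCone t₀).preimage (by fun_prop : Continuous fun r' : ℝ => (r' / s, s)))
      (fun g hg r' hr' => hasDerivAt_rField hg hr') hf ℓ (hmem s hs)
  have : (fun s => iteratedDeriv ℓ (fun r' => v s r') r) =ᶠ[nhds t]
      fun s => rField^[ℓ] f (r / s, s) := by
    filter_upwards [isOpen_Ioo.mem_nhds ht] with s hs using inner s hs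
  rw [pd, this.iteratedDeriv_eq]
  exact iteratedDeriv_comp_curve SmoothOn.tauField (γ := fun s => (r / s, s)) isOpen_Ioo
    (fun g hg s hs => hasDerivAt_tauField hg (hmem s hs)) (hf.iterate SmoothOn.rField ℓ) k ht

/-- Lemma 2: interior derivative bounds of all orders for the second
correction `v₂`. -/
theorem stmt5 (ν : ℝ) (hν : 3 < ν) :
    ∃ εstar > (0 : ℝ), ∀ ε₀ : ℝ, |ε₀| < εstar →
    ∀ t₀ : ℝ, 0 < t₀ →
    ∀ q : ℕ → ℝ → ℝ → ℝ, ∀ c : ℕ → ℝ → ℝ,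
    -- q_j smooth on {0 ≤ a ≤ 1, 0 < t < t₀}
    (∀ j ∈ ({1, 2} : Set ℕ), ContDiffOn ℝ (⊤ : ℕ∞) (fun p : ℝ × ℝ => q j p.1 p.2)
      {p : ℝ × ℝ | 0 ≤ p.1 ∧ p.1 ≤ 1 ∧ 0 < p.2 ∧ p.2 < t₀}) →
    -- c_j smooth with |∂_t^k c_j(t)| ≤ C_k t^{-k}
    (∀ j ∈ ({1, 2} : Set ℕ), ContDiffOn ℝ (⊤ : ℕ∞) (c j) (Set.Ioo 0 t₀)) →
    (∀ j ∈ ({1, 2} : Set ℕ), ∀ k : ℕ, ∃ C : ℝ, ∀ t : ℝ, 0 < t → t < t₀ →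
      |iteratedDeriv k (c j) t| ≤ C * (t ^ k)⁻¹) →
    -- boundary conditions
    (∀ j ∈ ({1, 2} : Set ℕ), ∀ t : ℝ, 0 < t → t < t₀ →
      q j 0 t = 0 ∧ pdat 1 0 (q j) 0 t = 0) →
    -- the equation
    (∀ j ∈ ({1, 2} : Set ℕ), ∀ a t : ℝ, 0 < a → a ≤ 1 → 0 < t → t < t₀ →
      (1 - a ^ 2) * pdat 2 0 (q j) a t
        + (2 * (betaJ ν ε₀ j t - 1) * a + 2 * a⁻¹) * pdat 1 0 (q j) a t
        + (-(betaJ ν ε₀ j t) ^ 2 + betaJ ν ε₀ j t - t * deriv (betaJ ν ε₀ j) t) * q j a t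
        - (t ^ 2 * pdat 0 2 (q j) a t + 2 * betaJ ν ε₀ j t * t * pdat 0 1 (q j) a t)
        + 2 * a * t * pdat 1 1 (q j) a t
        = c j t * a ^ (2 - j)) →
    -- the bounds for derivatives of order ℓ ≤ 2
    (∀ j ∈ ({1, 2} : Set ℕ), ∀ k : ℕ, ∃ C : ℝ, ∀ ℓ : ℕ, ℓ ≤ 2 →
      ∀ a t : ℝ, 0 ≤ a → a ≤ 1 → 0 < t → t < t₀ →
        |pdat ℓ k (q j) a t| ≤ C * (t ^ k)⁻¹ * a ^ (4 - j - ℓ)) →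
    -- conclusion: all-order derivative bounds for v₂ in the region 0 < r ≤ t/2
    ∀ k ℓ : ℕ, ∃ C : ℝ, ∀ t r : ℝ, 0 < t → t < t₀ → 0 < r → r ≤ t / 2 →
      |pd k ℓ (v2 ν ε₀ q) t r|
        ≤ C * (t ^ k)⁻¹ * (r ^ ℓ)⁻¹ *
            ((lam ν ε₀ t) ^ ((1 : ℝ) / 2) * (r / t) ^ 2 * (1 + r * lam ν ε₀ t)
              / (mu ν ε₀ t) ^ 2) := by
  refine ⟨1, one_pos, fun ε₀ _ t₀ _ q c hq hc hcb _ heq hb k ℓ => ?_⟩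
  have hP := isSymbolClass_coneSymbol t₀
  have hsub : innerCone t₀ ⊆ {p : ℝ × ℝ | 0 ≤ p.1 ∧ p.1 ≤ 1 ∧ 0 < p.2 ∧ p.2 < t₀} :=
    fun p hp => ⟨hp.1.le, hp.2.1.le.trans (by norm_num), hp.2.2⟩
  have hsol : ∀ j ∈ ({1, 2} : Set ℕ),
      ConeSymbol t₀ (Prod.fst ^ (4 - j)) (fun p => q j p.1 p.2) := fun j hj =>
    ConeSymbol.of_wave_solution hj ((hq j hj).mono hsub)
      (ConeSymbol.of_iteratedDeriv_snd (hc j hj) (hcb j hj)) (heq j hj) (hb j hj)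
  have hlam := ConeSymbol.lam_rpow ν ε₀ t₀ (1 / 2)
  have hmu := ConeSymbol.inv_mu ν ε₀ t₀
  let w : ℝ × ℝ → ℝ := fun p => lam ν ε₀ p.2 ^ ((1 : ℝ) / 2) * p.1 ^ 2
    * (1 + p.1 * p.2 * lam ν ε₀ p.2) / mu ν ε₀ p.2 ^ 2
  have h1 := hP.mono (w' := w) (hP.mul hlam (hP.mul hmu (hsol 1 (by simp)))) fun p hp => by
    have hl := lam_pos ν ε₀ hp.2.2.1
    have ht := hp.2.2.1
    have ha := hp.1
    simp only [w, mu, Pi.mul_apply, Pi.pow_apply]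
    refine ⟨by positivity, ?_⟩
    rw [← sub_nonneg]
    have : 0 ≤ lam ν ε₀ p.2 ^ ((1 : ℝ) / 2) * p.1 ^ 2 / (p.2 * lam ν ε₀ p.2) ^ 2 := by positivity
    convert this using 1
    field_simp
    ring
  have h2 := hP.mono (w' := w) (hP.mul hlam (hP.mul (hP.mul hmu hmu) (hsol 2 (by simp))))
    fun p hp => by
    have hl := lam_pos ν ε₀ hp.2.2.1
    have ht := hp.2.2.1
    have ha := hp.1
    simp only [w, mu, Pi.mul_apply, Pi.pow_apply]
    refine ⟨by positivity, ?_⟩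
    rw [← sub_nonneg]
    have : 0 ≤ lam ν ε₀ p.2 ^ ((1 : ℝ) / 2) * p.1 ^ 3 / (p.2 * lam ν ε₀ p.2) := by positivity
    convert this using 1
    field_simp
    ring
  have hv := hP.add h1 h2
  obtain ⟨C, hC⟩ := ((hv.rField_iterate ℓ).tauField_iterate k).base.base.2
  refine ⟨C, fun t r ht ht₀ hr hrt => ?_⟩
  have hp : (r / t, t) ∈ innerCone t₀ :=
    ⟨div_pos hr ht, (div_lt_iff₀ ht).2 (by linarith), ht, ht₀⟩
  rw [pd_eq_fields (hP.smooth hv) (fun t r => ?_) k ℓ ht₀ hr (by linarith)]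
  · refine (hC _ hp).trans_eq ?_
    simp only [w, Pi.mul_apply, Pi.pow_apply, div_mul_cancel₀ r ht.ne']
    rw [← mul_inv, div_mul_cancel₀ r ht.ne', inv_pow, inv_pow]
    ring
  · simp only [v2, Pi.add_apply, Pi.mul_apply]
    ring
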